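/- arXiv:math/0601516 — 11 statements merged into one kernel-verified Lean document; each statement's English description precedes it below -/
import Mathlib

section
/- For every i ∈ ℤ/rℤ, one has i ∈ J if and only if β_i > 0, and i ∈ J if and only if α_i ≤ 0. -/
open Finset

/-- Indicator function (as an integer) of a subset `J ⊆ ℤ/rℤ`:
`dlt J i = 1` if `i ∈ J` and `0` otherwise.  Note that the indicator of the
complement `Jᶜ` is `1 - dlt J i`. -/
def dlt {r : ℕ} (J : Finset (ZMod r)) (i : ZMod r) : ℤ :=
  if i ∈ J then 1 else 0

/-- `α_i = Σ_{j=0}^{r−1} p^{r−1−j} (b_{i+j} δ_{J^c}(i+j) − δ_{J^c}(i+j+1))`. -/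
def alph (p r : ℕ) (J : Finset (ZMod r)) (b : ZMod r → ℤ) (i : ZMod r) : ℤ :=
  ∑ j ∈ Finset.range r, (p : ℤ) ^ (r - 1 - j) *
    (b (i + (j : ZMod r)) * (1 - dlt J (i + (j : ZMod r))) -
      (1 - dlt J (i + (j : ZMod r) + 1)))

/-- `β_i = Σ_{j=0}^{r−1} p^{r−1−j} (b_{i+j} δ_J(i+j) − δ_J(i+j+1))`. -/
def bet (p r : ℕ) (J : Finset (ZMod r)) (b : ZMod r → ℤ) (i : ZMod r) : ℤ :=
  ∑ j ∈ Finset.range r, (p : ℤ) ^ (r - 1 - j) *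
    (b (i + (j : ZMod r)) * dlt J (i + (j : ZMod r)) -
      dlt J (i + (j : ZMod r) + 1))

/-- Horner recursion for the truncated base-`p` sums. -/
lemma sum_range_succ_pow_mul (p : ℤ) (c : ℕ → ℤ) (n : ℕ) :
    ∑ j ∈ range (n + 1), p ^ (n - j) * c j =
      p * ∑ j ∈ range n, p ^ (n - 1 - j) * c j + c n := by
  rw [sum_range_succ, mul_sum, Nat.sub_self, pow_zero, one_mul]
  congr 1
  refine sum_congr rfl fun j hj => ?_
  have hj' : n - j = (n - 1 - j) + 1 := by
    have := mem_range.mp hj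
    omega
  rw [hj', pow_succ]
  ring

/-- If `d 0 = 1`, the twisted base-`p` sum is positive. -/
lemma sum_pow_mul_pos {p : ℤ} (hp : 2 ≤ p) {b d : ℕ → ℤ} (hb : ∀ j, 2 ≤ b j)
    (hd : ∀ j, d j = 0 ∨ d j = 1) (h : d 0 = 1) (n : ℕ) :
    0 < ∑ j ∈ range (n + 1), p ^ (n - j) * (b j * d j - d (j + 1)) := by
  induction n with
  | zero =>
    have := hb 0
    rcases hd 1 with h1 | h1 <;> simp [h, h1] <;> omega
  | succ n ih =>
    rw [sum_range_succ_pow_mul p (fun j => b j * d j - d (j + 1))]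
    simp only [Nat.add_sub_cancel]
    have := hb (n + 1)
    rcases hd (n + 1) with h1 | h1 <;> rcases hd (n + 1 + 1) with h2 | h2 <;>
      rw [h1, h2] <;> nlinarith

/-- If `d 0 = 0`, the twisted base-`p` sum is bounded above by `-d (n + 1)`. -/
lemma sum_pow_mul_le {p : ℤ} (hp : 0 ≤ p) {b d : ℕ → ℤ} (hb : ∀ j, b j ≤ p)
    (hd : ∀ j, d j = 0 ∨ d j = 1) (h : d 0 = 0) (n : ℕ) :
    ∑ j ∈ range (n + 1), p ^ (n - j) * (b j * d j - d (j + 1)) ≤ -d (n + 1) := by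
  induction n with
  | zero => simp [h]
  | succ n ih =>
    rw [sum_range_succ_pow_mul p (fun j => b j * d j - d (j + 1))]
    simp only [Nat.add_sub_cancel]
    have := hb (n + 1)
    rcases hd (n + 1) with h1 | h1 <;> rw [h1] at ih ⊢ <;> nlinarith

/-- The twisted base-`p` sum is positive exactly when `d 0 = 1`. -/
lemma sum_pow_mul_pos_iff {p : ℤ} (hp : 2 ≤ p) {b d : ℕ → ℤ}
    (hb : ∀ j, 2 ≤ b j ∧ b j ≤ p) (hd : ∀ j, d j = 0 ∨ d j = 1) {r : ℕ} (hr : 1 ≤ r) :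
    0 < ∑ j ∈ range r, p ^ (r - 1 - j) * (b j * d j - d (j + 1)) ↔ d 0 = 1 := by
  obtain ⟨n, rfl⟩ := Nat.exists_eq_add_of_le' hr
  simp only [Nat.add_sub_cancel]
  refine ⟨fun hpos => (hd 0).resolve_left fun h => ?_,
    fun h => sum_pow_mul_pos hp (fun j => (hb j).1) hd h n⟩
  have hle := sum_pow_mul_le (by omega) (fun j => (hb j).2) hd h n
  rcases hd (n + 1) with h1 | h1 <;> omega

/-- For every i, i ∈ J iff β_i > 0, and i ∈ J iff α_i ≤ 0. -/
theorem stmt2 (p r : ℕ) (hp : p.Prime) (hp5 : 5 ≤ p) (hr : 1 ≤ r)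
    (J : Finset (ZMod r)) (b : ZMod r → ℤ)
    (hb : ∀ i : ZMod r, 2 ≤ b i ∧ b i ≤ (p : ℤ) - 2) :
    ∀ i : ZMod r, (i ∈ J ↔ 0 < bet p r J b i) ∧ (i ∈ J ↔ alph p r J b i ≤ 0) := by
  intro i
  have hp2 : (2 : ℤ) ≤ p := by omega
  have hb' : ∀ j : ℕ, 2 ≤ b (i + j) ∧ b (i + j) ≤ p := fun j =>
    ⟨(hb _).1, by linarith [(hb (i + j)).2]⟩
  have hd : ∀ j : ℕ, dlt J (i + j) = 0 ∨ dlt J (i + j) = 1 := fun j => by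
    unfold dlt
    split_ifs <;> simp
  have hd' : ∀ j : ℕ, 1 - dlt J (i + j) = 0 ∨ 1 - dlt J (i + j) = 1 := fun j => by
    have := hd j
    omega
  have hβ := sum_pow_mul_pos_iff hp2 hb' hd hr
  have hα := sum_pow_mul_pos_iff hp2 hb' hd' hr
  simp only [Nat.cast_add, Nat.cast_one, Nat.cast_zero, add_zero, ← add_assoc] at hβ hα
  constructor
  · rw [bet, hβ]
    simp [dlt]
  · rw [← not_lt, alph, hα]
    simp [dlt]
end

section
/- For every i ∈ ℤ/rℤ one has −e < (p−1)·α_i < e·(p−2) and −e < (p−1)·β_i < e·(p−2) (that is, −e/(p−1) < α_i, β_i < e(p−2)/(p−1)). -/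
open Finset

theorem sub_one_mul_sum_pow_reflect (q : ℤ) (r : ℕ) :
    (q - 1) * ∑ j ∈ range r, q ^ (r - 1 - j) = q ^ r - 1 := by
  rw [sum_range_reflect (fun j => q ^ j) r, mul_geom_sum]

theorem add_natCast_pred_add_one {r : ℕ} (hr : 1 ≤ r) (i : ZMod r) :
    i + ((r - 1 : ℕ) : ZMod r) + 1 = i := by
  rw [add_assoc, ← Nat.cast_add_one, Nat.sub_add_cancel hr, ZMod.natCast_self, add_zero]

/-- The digits `b k * x k - x (k + 1)` of a cyclic `0`-`1` sequence `x` lie in `[-1, q - 2]`, and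
they are neither all `-1` nor all `q - 2`. This bounds the number with these digits in base `q`. -/
theorem cyclic_digit_sum_bounds {q : ℤ} (hq : 2 ≤ q) {r : ℕ} (hr : 1 ≤ r) {x b : ZMod r → ℤ}
    (hx : ∀ k, x k = 0 ∨ x k = 1) (hb : ∀ k, 2 ≤ b k ∧ b k ≤ q - 2) (i : ZMod r) :
    -(q ^ r - 1) < (q - 1) * ∑ j ∈ range r, q ^ (r - 1 - j) *
        (b (i + (j : ZMod r)) * x (i + (j : ZMod r)) - x (i + (j : ZMod r) + 1)) ∧
      (q - 1) * ∑ j ∈ range r, q ^ (r - 1 - j) *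
        (b (i + (j : ZMod r)) * x (i + (j : ZMod r)) - x (i + (j : ZMod r) + 1)) <
          (q ^ r - 1) * (q - 2) := by
  have hpos (j : ℕ) : 0 < q ^ (r - 1 - j) := by positivity
  have hlast := add_natCast_pred_add_one hr i
  have digit (k : ZMod r) : -1 ≤ b k * x k - x (k + 1) ∧ b k * x k - x (k + 1) ≤ q - 2 := by
    have := hb k
    rcases hx k with h | h <;> rcases hx (k + 1) with h' | h' <;> rw [h, h'] <;> omega
  have digit_zero (k : ZMod r) (h : x k = 0) : b k * x k - x (k + 1) < q - 2 := by
    have := hb k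
    rcases hx (k + 1) with h' | h' <;> rw [h, h'] <;> omega
  have digit_one (k : ZMod r) (h : x k = 1) : -1 < b k * x k - x (k + 1) := by
    have := hb k
    rcases hx (k + 1) with h' | h' <;> rw [h, h'] <;> omega
  have digit_next_zero (k : ZMod r) (h : x (k + 1) = 0) : -1 < b k * x k - x (k + 1) := by
    have := hb k
    rcases hx k with h' | h' <;> rw [h, h'] <;> omega
  have digit_next_one (k : ZMod r) (h : x (k + 1) = 1) : b k * x k - x (k + 1) < q - 2 := by
    have := hb k
    rcases hx k with h' | h' <;> rw [h, h'] <;> omega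
  have lower : ∑ j ∈ range r, q ^ (r - 1 - j) * (-1) < ∑ j ∈ range r, q ^ (r - 1 - j) *
      (b (i + (j : ZMod r)) * x (i + (j : ZMod r)) - x (i + (j : ZMod r) + 1)) := by
    refine sum_lt_sum (fun j _ => mul_le_mul_of_nonneg_left (digit _).1 (hpos j).le) ?_
    rcases hx i with h | h
    · exact ⟨r - 1, mem_range.2 (by omega), mul_lt_mul_of_pos_left
        (digit_next_zero _ (by rwa [hlast])) (hpos _)⟩
    · exact ⟨0, mem_range.2 (by omega), mul_lt_mul_of_pos_left
        (digit_one _ (by simpa using h)) (hpos _)⟩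
  have upper : ∑ j ∈ range r, q ^ (r - 1 - j) *
      (b (i + (j : ZMod r)) * x (i + (j : ZMod r)) - x (i + (j : ZMod r) + 1)) <
        ∑ j ∈ range r, q ^ (r - 1 - j) * (q - 2) := by
    refine sum_lt_sum (fun j _ => mul_le_mul_of_nonneg_left (digit _).2 (hpos j).le) ?_
    rcases hx i with h | h
    · exact ⟨0, mem_range.2 (by omega), mul_lt_mul_of_pos_left
        (digit_zero _ (by simpa using h)) (hpos _)⟩
    · exact ⟨r - 1, mem_range.2 (by omega), mul_lt_mul_of_pos_left
        (digit_next_one _ (by rwa [hlast])) (hpos _)⟩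
  rw [← sum_mul] at lower upper
  have hq1 : 0 < q - 1 := by omega
  rw [← sub_one_mul_sum_pow_reflect q r]
  constructor
  · linarith [mul_lt_mul_of_pos_left lower hq1]
  · linarith [mul_lt_mul_of_pos_left upper hq1]

theorem dlt_eq_zero_or_one {r : ℕ} (J : Finset (ZMod r)) (i : ZMod r) :
    dlt J i = 0 ∨ dlt J i = 1 := by
  unfold dlt
  split_ifs <;> simp

/-- For every i: -e < (p-1)*α_i < e*(p-2) and -e < (p-1)*β_i < e*(p-2), where e = p^r - 1. -/
theorem stmt3 (p r : ℕ) (hp : p.Prime) (hp5 : 5 ≤ p) (hr : 1 ≤ r)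
    (J : Finset (ZMod r)) (b : ZMod r → ℤ)
    (hb : ∀ i : ZMod r, 2 ≤ b i ∧ b i ≤ (p : ℤ) - 2) :
    ∀ i : ZMod r,
      (-((p : ℤ) ^ r - 1) < ((p : ℤ) - 1) * alph p r J b i ∧
        ((p : ℤ) - 1) * alph p r J b i < ((p : ℤ) ^ r - 1) * ((p : ℤ) - 2)) ∧
      (-((p : ℤ) ^ r - 1) < ((p : ℤ) - 1) * bet p r J b i ∧
        ((p : ℤ) - 1) * bet p r J b i < ((p : ℤ) ^ r - 1) * ((p : ℤ) - 2)) := by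
  have hq : (2 : ℤ) ≤ p := by exact_mod_cast hp.two_le
  exact fun i =>
    ⟨cyclic_digit_sum_bounds (x := fun k => 1 - dlt J k) hq hr
        (fun k => by have := dlt_eq_zero_or_one J k; omega) hb i,
      cyclic_digit_sum_bounds hq hr (dlt_eq_zero_or_one J) hb i⟩
end

section
/- For every i ∈ ℤ/rℤ, p does not divide ι_i, and moreover p·ι_i ≥ e. -/
open Finset

/-- `ι_i = α_{i+1} − β_{i+1} + e·δ_J(i+1)`, where `e = p^r − 1`. -/
def iot (p r : ℕ) (J : Finset (ZMod r)) (b : ZMod r → ℤ) (i : ZMod r) : ℤ :=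
  alph p r J b (i + 1) - bet p r J b (i + 1) + ((p : ℤ) ^ r - 1) * dlt J (i + 1)

theorem sum_range_pow_sub_succ (p : ℤ) (f : ℕ → ℤ) (n : ℕ) :
    ∑ j ∈ range (n + 2), p ^ (n + 1 - j) * f j =
      p * ∑ j ∈ range (n + 1), p ^ (n - j) * f j + f (n + 1) := by
  rw [sum_range_succ, mul_sum]
  congr 1
  · refine sum_congr rfl fun j hj => ?_
    rw [Nat.succ_sub (Nat.lt_succ_iff.mp (mem_range.mp hj)), pow_succ]
    ring
  · simp

/-- A signed digit sum `∑ p ^ (n - j) * (c j * s j - s (j + 1))` is dominated by its leading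
digit, up to an error of at most `p ^ n - 1`. -/
theorem abs_signed_digit_sum_sub_le {p : ℤ} (hp : 0 ≤ p) {c s : ℕ → ℤ}
    (hc : ∀ j, 2 ≤ c j ∧ c j ≤ p - 2) (hs : ∀ j, s j = 1 ∨ s j = -1) (n : ℕ) :
    |∑ j ∈ range (n + 1), p ^ (n - j) * (c j * s j - s (j + 1)) + s (n + 1) -
      c 0 * s 0 * p ^ n| ≤ p ^ n - 1 := by
  induction n with
  | zero => simp
  | succ n ih =>
    rw [sum_range_pow_sub_succ]
    set A := ∑ j ∈ range (n + 1), p ^ (n - j) * (c j * s j - s (j + 1))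
    obtain ⟨h1, h2⟩ := hc (n + 1)
    rw [abs_le] at ih ⊢
    have hlo := mul_le_mul_of_nonneg_left ih.1 hp
    have hhi := mul_le_mul_of_nonneg_left ih.2 hp
    rw [pow_succ]
    rcases hs (n + 1) with h | h <;> rw [h] at hlo hhi ⊢ <;> constructor <;> linarith

theorem iot_eq_sum (p n : ℕ) (J : Finset (ZMod (n + 1))) (b : ZMod (n + 1) → ℤ)
    (i : ZMod (n + 1)) :
    iot p (n + 1) J b i =
      ∑ j ∈ range (n + 1), (p : ℤ) ^ (n - j) *
        (b (i + 1 + (j : ZMod (n + 1))) * (1 - 2 * dlt J (i + 1 + (j : ZMod (n + 1)))) -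
          (1 - 2 * dlt J (i + 1 + ((j + 1 : ℕ) : ZMod (n + 1))))) +
        ((p : ℤ) ^ (n + 1) - 1) * dlt J (i + 1) := by
  rw [iot, alph, bet, ← sum_sub_distrib]
  congr 1
  refine sum_congr rfl fun j _ => ?_
  rw [Nat.add_sub_cancel, Nat.cast_succ, ← add_assoc]
  ring

/-- For every i, p does not divide ι_i, and moreover p*ι_i ≥ e. -/
theorem stmt5 (p r : ℕ) (hp : p.Prime) (hp5 : 5 ≤ p) (hr : 1 ≤ r)
    (J : Finset (ZMod r)) (b : ZMod r → ℤ)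
    (hb : ∀ i : ZMod r, 2 ≤ b i ∧ b i ≤ (p : ℤ) - 2) :
    ∀ i : ZMod r,
      ¬ ((p : ℤ) ∣ iot p r J b i) ∧ ((p : ℤ) ^ r - 1) ≤ (p : ℤ) * iot p r J b i := by
  obtain ⟨n, rfl⟩ : ∃ n, r = n + 1 := ⟨r - 1, by omega⟩
  intro i
  rw [iot_eq_sum]
  set c : ℕ → ℤ := fun j => b (i + 1 + (j : ZMod (n + 1))) with hc_def
  set s : ℕ → ℤ := fun j => 1 - 2 * dlt J (i + 1 + (j : ZMod (n + 1))) with hs_def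
  have hc : ∀ j, 2 ≤ c j ∧ c j ≤ (p : ℤ) - 2 := fun j => hb _
  have hs : ∀ j, s j = 1 ∨ s j = -1 := fun j => by
    rcases dlt_eq_zero_or_one J (i + 1 + (j : ZMod (n + 1))) with h | h <;> simp [hs_def, h]
  have hs0 : s 0 = 1 - 2 * dlt J (i + 1) := by simp [hs_def]
  have hsn : s (n + 1) = 1 - 2 * dlt J (i + 1) := by
    simp only [hs_def, ZMod.natCast_self, add_zero]
  have hd := dlt_eq_zero_or_one J (i + 1)
  change ¬ (p : ℤ) ∣ ∑ j ∈ range (n + 1), (p : ℤ) ^ (n - j) * (c j * s j - s (j + 1)) + _ ∧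
    _ ≤ (p : ℤ) * (∑ j ∈ range (n + 1), (p : ℤ) ^ (n - j) * (c j * s j - s (j + 1)) + _)
  have hp5' : (5 : ℤ) ≤ p := by exact_mod_cast hp5
  constructor
  · obtain ⟨m, hm⟩ : ∃ m, ∑ j ∈ range (n + 1), (p : ℤ) ^ (n - j) * (c j * s j - s (j + 1)) =
        p * m + (c n * s n - s (n + 1)) := by
      cases n with
      | zero => exact ⟨0, by simp⟩
      | succ n => exact ⟨_, sum_range_pow_sub_succ _ _ _⟩
    rw [hm, hsn]
    intro hdvd
    have hres : (p : ℤ) ∣ c n * s n - 1 + dlt J (i + 1) := by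
      rw [show c n * s n - 1 + dlt J (i + 1) =
        p * m + (c n * s n - (1 - 2 * dlt J (i + 1))) +
          ((p : ℤ) ^ (n + 1) - 1) * dlt J (i + 1) - p * (m + (p : ℤ) ^ n * dlt J (i + 1)) by ring]
      exact dvd_sub hdvd (dvd_mul_right _ _)
    obtain ⟨h1, h2⟩ := hc n
    have hzero := Int.eq_zero_of_abs_lt_dvd hres (by
      rw [abs_lt]
      rcases hs n with h | h <;> rcases hd with h' | h' <;> rw [h, h'] <;> constructor <;> linarith)
    rcases hs n with h | h <;> rcases hd with h' | h' <;> rw [h, h'] at hzero <;> linarith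
  · have hbound := abs_signed_digit_sum_sub_le (by linarith) hc hs n
    rw [hsn, hs0] at hbound
    set A := ∑ j ∈ range (n + 1), (p : ℤ) ^ (n - j) * (c j * s j - s (j + 1))
    obtain ⟨h1, h2⟩ := hc 0
    have hpos : (0 : ℤ) ≤ (p : ℤ) ^ n := by positivity
    have hlead1 := mul_le_mul_of_nonneg_right h1 hpos
    have hlead2 := mul_le_mul_of_nonneg_right h2 hpos
    have hA : (p : ℤ) ^ n ≤ A + ((p : ℤ) ^ (n + 1) - 1) * dlt J (i + 1) := by
      have hlo := (abs_le.mp hbound).1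
      rw [pow_succ]
      rcases hd with h | h <;> rw [h] at hlo ⊢ <;> linarith
    have := mul_le_mul_of_nonneg_left hA (by linarith : (0 : ℤ) ≤ p)
    rw [← pow_succ'] at this
    linarith
end

section
/- For every i ∈ ℤ/rℤ one has the congruence ι_i ≡ b_i·(δ_{J^c}(i) − δ_J(i)) − δ_{J^c}(i+1) (mod p); in particular ι_i is never congruent to 0 modulo p. -/
open Finset

/-- A base-`p` expansion of positive length is congruent to its last digit modulo `p`. -/
theorem sum_pow_mul_modEq_last (p : ℤ) {r : ℕ} (hr : 1 ≤ r) (f : ℕ → ℤ) :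
    ∑ j ∈ Finset.range r, p ^ (r - 1 - j) * f j ≡ f (r - 1) [ZMOD p] := by
  obtain ⟨n, rfl⟩ : ∃ n, r = n + 1 := ⟨r - 1, by omega⟩
  rw [Finset.sum_range_succ, Int.modEq_iff_dvd]
  have hdvd : p ∣ ∑ j ∈ Finset.range n, p ^ (n + 1 - 1 - j) * f j :=
    Finset.dvd_sum fun j hj =>
      (dvd_pow_self p (by have := Finset.mem_range.mp hj; omega)).mul_right _
  simpa [sub_add_eq_sub_sub_swap] using hdvd

theorem add_one_add_cast_pred {r : ℕ} (hr : 1 ≤ r) (i : ZMod r) :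
    i + 1 + ((r - 1 : ℕ) : ZMod r) = i := by
  rw [Nat.cast_sub hr]
  simp

theorem alph_add_one_modEq (p : ℕ) {r : ℕ} (hr : 1 ≤ r) (J : Finset (ZMod r))
    (b : ZMod r → ℤ) (i : ZMod r) :
    alph p r J b (i + 1) ≡ b i * (1 - dlt J i) - (1 - dlt J (i + 1)) [ZMOD (p : ℤ)] := by
  have h := sum_pow_mul_modEq_last (p : ℤ) hr fun j =>
    b (i + 1 + (j : ZMod r)) * (1 - dlt J (i + 1 + (j : ZMod r))) -
      (1 - dlt J (i + 1 + (j : ZMod r) + 1))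
  simpa only [alph, add_one_add_cast_pred hr] using h

theorem bet_add_one_modEq (p : ℕ) {r : ℕ} (hr : 1 ≤ r) (J : Finset (ZMod r))
    (b : ZMod r → ℤ) (i : ZMod r) :
    bet p r J b (i + 1) ≡ b i * dlt J i - dlt J (i + 1) [ZMOD (p : ℤ)] := by
  have h := sum_pow_mul_modEq_last (p : ℤ) hr fun j =>
    b (i + 1 + (j : ZMod r)) * dlt J (i + 1 + (j : ZMod r)) -
      dlt J (i + 1 + (j : ZMod r) + 1)
  simpa only [bet, add_one_add_cast_pred hr] using h

theorem iot_modEq (p : ℕ) {r : ℕ} (hr : 1 ≤ r) (J : Finset (ZMod r))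
    (b : ZMod r → ℤ) (i : ZMod r) :
    iot p r J b i ≡ b i * ((1 - dlt J i) - dlt J i) - (1 - dlt J (i + 1)) [ZMOD (p : ℤ)] := by
  have he : (p : ℤ) ^ r - 1 ≡ 0 - 1 [ZMOD (p : ℤ)] :=
    (Int.modEq_zero_iff_dvd.mpr (dvd_pow_self _ (by omega))).sub_right 1
  have h := ((alph_add_one_modEq p hr J b i).sub (bet_add_one_modEq p hr J b i)).add
    (he.mul_right (dlt J (i + 1)))
  convert h using 1
  · rfl
  · ring

theorem not_dvd_residue {p c : ℤ} (hc : 2 ≤ c ∧ c ≤ p - 2) {r : ℕ} (J : Finset (ZMod r))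
    (i k : ZMod r) : ¬ p ∣ c * ((1 - dlt J i) - dlt J i) - (1 - dlt J k) := by
  intro h
  have hlt : |c * ((1 - dlt J i) - dlt J i) - (1 - dlt J k)| < p := by
    rw [abs_lt]
    unfold dlt
    split_ifs <;> constructor <;> linarith
  have h0 := Int.eq_zero_of_abs_lt_dvd h hlt
  unfold dlt at h0
  split_ifs at h0 <;> linarith

/-- For every i, ι_i ≡ b_i*(δ_Jc(i) - δ_J(i)) - δ_Jc(i+1) mod p; in particular
ι_i is never congruent to 0 modulo p. -/
theorem stmt6 (p r : ℕ) (hp : p.Prime) (hp5 : 5 ≤ p) (hr : 1 ≤ r)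
    (J : Finset (ZMod r)) (b : ZMod r → ℤ)
    (hb : ∀ i : ZMod r, 2 ≤ b i ∧ b i ≤ (p : ℤ) - 2) :
    ∀ i : ZMod r,
      iot p r J b i ≡ b i * ((1 - dlt J i) - dlt J i) - (1 - dlt J (i + 1)) [ZMOD (p : ℤ)] ∧
      ¬ (iot p r J b i ≡ 0 [ZMOD (p : ℤ)]) := by
  intro i
  have h := iot_modEq p hr J b i
  exact ⟨h, fun h0 => not_dvd_residue (hb i) J i (i + 1)
    (Int.modEq_zero_iff_dvd.mp (h.symm.trans h0))⟩
end

section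
/- For every i ∈ ℤ/rℤ one has 0 ≤ n_i ≤ (p−2)·e and 0 ≤ n'_i ≤ (p−2)·e. -/
open Finset

/-- `n_i = (p−2−δ_{J^c}(i)·b_i)·e + p·δ_{J^c}(i)·α_i − δ_{J^c}(i+1)·α_{i+1}`,
where `e = p^r − 1`. -/
def nn (p r : ℕ) (J : Finset (ZMod r)) (b : ZMod r → ℤ) (i : ZMod r) : ℤ :=
  ((p : ℤ) - 2 - (1 - dlt J i) * b i) * ((p : ℤ) ^ r - 1) +
    (p : ℤ) * (1 - dlt J i) * alph p r J b i -
      (1 - dlt J (i + 1)) * alph p r J b (i + 1)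

/-- `n'_i = (p−2−δ_J(i)·b_i)·e + p·δ_J(i)·β_i − δ_J(i+1)·β_{i+1}`,
where `e = p^r − 1`. -/
def nn' (p r : ℕ) (J : Finset (ZMod r)) (b : ZMod r → ℤ) (i : ZMod r) : ℤ :=
  ((p : ℤ) - 2 - dlt J i * b i) * ((p : ℤ) ^ r - 1) +
    (p : ℤ) * dlt J i * bet p r J b i -
      dlt J (i + 1) * bet p r J b (i + 1)

/-- The integer with base-`p` digits `c k, c (k + 1), …, c (k + m - 1)`, leading digit first. -/
def digitSum {r : ℕ} (p : ℕ) (c : ZMod r → ℤ) (m : ℕ) (k : ZMod r) : ℤ :=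
  ∑ j ∈ Finset.range m, (p : ℤ) ^ (m - 1 - j) * c (k + (j : ZMod r))

theorem digitSum_succ_left {r : ℕ} (p : ℕ) (c : ZMod r → ℤ) (m : ℕ) (k : ZMod r) :
    digitSum p c (m + 1) k = (p : ℤ) ^ m * c k + digitSum p c m (k + 1) := by
  unfold digitSum
  rw [Finset.sum_range_succ', add_comm]
  congr 1
  · simp
  · refine Finset.sum_congr rfl fun j _ => ?_
    rw [show m + 1 - 1 - (j + 1) = m - 1 - j by omega]
    push_cast
    rw [show k + ((j : ZMod r) + 1) = k + 1 + j by ring]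

theorem digitSum_succ_right {r : ℕ} (p : ℕ) (c : ZMod r → ℤ) (m : ℕ) (k : ZMod r) :
    digitSum p c (m + 1) k = p * digitSum p c m k + c (k + m) := by
  unfold digitSum
  rw [Finset.sum_range_succ, Finset.mul_sum]
  congr 1
  · refine Finset.sum_congr rfl fun j hj => ?_
    have hj' := Finset.mem_range.mp hj
    rw [show m + 1 - 1 - j = (m - 1 - j) + 1 by omega, pow_succ]
    ring
  · simp

theorem mul_digitSum_sub_digitSum {r : ℕ} (p : ℕ) (c : ZMod r → ℤ) (k : ZMod r) :
    p * digitSum p c r k - digitSum p c r (k + 1) = ((p : ℤ) ^ r - 1) * c k := by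
  have h := (digitSum_succ_left p c r k).symm.trans (digitSum_succ_right p c r k)
  rw [ZMod.natCast_self, add_zero] at h
  linarith

theorem digitSum_bounds {r p : ℕ} (hp : 2 ≤ p) {d b : ZMod r → ℤ}
    (hd : ∀ i, d i = 0 ∨ d i = 1) (hb : ∀ i, 2 ≤ b i ∧ b i ≤ (p : ℤ) - 2) (m : ℕ)
    (k : ZMod r) :
    (d k = 1 → 0 ≤ digitSum p (fun i => b i * d i - d (i + 1)) m k ∧
      digitSum p (fun i => b i * d i - d (i + 1)) m k ≤ (p : ℤ) ^ m - 1) ∧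
    (d k = 0 → -((p : ℤ) ^ m - 1) ≤ digitSum p (fun i => b i * d i - d (i + 1)) m k ∧
      digitSum p (fun i => b i * d i - d (i + 1)) m k ≤ 0) := by
  induction m generalizing k with
  | zero => simp [digitSum]
  | succ m ih =>
    have hp' : (2 : ℤ) ≤ p := by exact_mod_cast hp
    have hm : (1 : ℤ) ≤ (p : ℤ) ^ m := one_le_pow₀ (by linarith)
    obtain ⟨h1, h0⟩ := ih (k + 1)
    obtain ⟨hl, hu⟩ := hb k
    have hlm := mul_le_mul_of_nonneg_left hl (by linarith : (0 : ℤ) ≤ (p : ℤ) ^ m)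
    have hum := mul_le_mul_of_nonneg_left hu (by linarith : (0 : ℤ) ≤ (p : ℤ) ^ m)
    have hpm := mul_le_mul_of_nonneg_left hp' (by linarith : (0 : ℤ) ≤ (p : ℤ) ^ m)
    rw [digitSum_succ_left, pow_succ]
    rcases hd (k + 1) with h | h
    · obtain ⟨ha, hc⟩ := h0 h
      refine ⟨fun hk => ?_, fun hk => ?_⟩ <;> simp only [h, hk] <;>
        constructor <;> linarith
    · obtain ⟨ha, hc⟩ := h1 h
      refine ⟨fun hk => ?_, fun hk => ?_⟩ <;> simp only [h, hk] <;>
        constructor <;> linarith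

theorem weighted_digitSum_bounds {r p : ℕ} (hp : 3 ≤ p) {d b : ZMod r → ℤ}
    (hd : ∀ i, d i = 0 ∨ d i = 1) (hb : ∀ i, 2 ≤ b i ∧ b i ≤ (p : ℤ) - 2) {A : ZMod r → ℤ}
    (hA : ∀ i, A i = digitSum p (fun i => b i * d i - d (i + 1)) r i) (i : ZMod r) :
    0 ≤ ((p : ℤ) - 2 - d i * b i) * ((p : ℤ) ^ r - 1) + p * d i * A i - d (i + 1) * A (i + 1) ∧
    ((p : ℤ) - 2 - d i * b i) * ((p : ℤ) ^ r - 1) + p * d i * A i - d (i + 1) * A (i + 1) ≤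
      ((p : ℤ) - 2) * ((p : ℤ) ^ r - 1) := by
  have hp' : (3 : ℤ) ≤ p := by exact_mod_cast hp
  have he : (0 : ℤ) ≤ (p : ℤ) ^ r - 1 := sub_nonneg.mpr (one_le_pow₀ (by linarith))
  have hrec := mul_digitSum_sub_digitSum p (fun i => b i * d i - d (i + 1)) i
  obtain ⟨h1, h0⟩ := digitSum_bounds (by omega) hd hb r (i + 1)
  have hpe := mul_le_mul_of_nonneg_right hp' he
  obtain ⟨hl, hu⟩ := hb i
  simp only [← hA] at hrec h1 h0
  rcases hd i with hi | hi <;> rcases hd (i + 1) with hs | hs <;>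
    simp only [hi, hs, true_implies] at hrec h1 h0 ⊢ <;> constructor <;> linarith

/-- For every i, 0 ≤ n_i ≤ (p-2)*e and 0 ≤ n'_i ≤ (p-2)*e. -/
theorem stmt7 (p r : ℕ) (hp : p.Prime) (hp5 : 5 ≤ p) (hr : 1 ≤ r)
    (J : Finset (ZMod r)) (b : ZMod r → ℤ)
    (hb : ∀ i : ZMod r, 2 ≤ b i ∧ b i ≤ (p : ℤ) - 2) :
    ∀ i : ZMod r,
      (0 ≤ nn p r J b i ∧ nn p r J b i ≤ ((p : ℤ) - 2) * ((p : ℤ) ^ r - 1)) ∧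
      (0 ≤ nn' p r J b i ∧ nn' p r J b i ≤ ((p : ℤ) - 2) * ((p : ℤ) ^ r - 1)) := by
  intro i
  have hd := dlt_eq_zero_or_one J
  have hd' : ∀ i, 1 - dlt J i = 0 ∨ 1 - dlt J i = 1 := fun i => by
    rcases hd i with h | h <;> simp [h]
  exact ⟨weighted_digitSum_bounds (d := fun i => 1 - dlt J i) (A := alph p r J b) (by omega)
      hd' hb (fun _ => rfl) i,
    weighted_digitSum_bounds (A := bet p r J b) (by omega) hd hb (fun _ => rfl) i⟩
end

section
/- For every i ∈ ℤ/rℤ with i+1 ∈ J, one has n_i ≥ β_{i+1}. -/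
open Finset

/-- A base-`p` expansion with digits at most `p - 1` is at most `p ^ r - 1`. -/
theorem sum_pow_mul_le_pow_sub_one {p : ℤ} (hp : 0 ≤ p) (r : ℕ) {f : ℕ → ℤ}
    (hf : ∀ j, f j ≤ p - 1) :
    ∑ j ∈ Finset.range r, p ^ (r - 1 - j) * f j ≤ p ^ r - 1 := by
  calc ∑ j ∈ Finset.range r, p ^ (r - 1 - j) * f j
      ≤ ∑ j ∈ Finset.range r, p ^ (r - 1 - j) * (p - 1) :=
        Finset.sum_le_sum fun j _ => mul_le_mul_of_nonneg_left (hf j) (by positivity)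
    _ = p ^ r - 1 := by
        rw [Finset.sum_range_reflect (fun j => p ^ j * (p - 1)) r, ← Finset.sum_mul,
          geom_sum_mul]

/-- Shifting the digits of a base-`p` expansion by one place. -/
theorem mul_sum_pow_mul_add (p : ℤ) (r : ℕ) (f : ℕ → ℤ) :
    p * ∑ j ∈ Finset.range r, p ^ (r - 1 - j) * f j + f r =
      p ^ r * f 0 + ∑ j ∈ Finset.range r, p ^ (r - 1 - j) * f (j + 1) := by
  have h₁ := Finset.sum_range_succ (fun j => p ^ (r - j) * f j) r
  have h₂ := Finset.sum_range_succ' (fun j => p ^ (r - j) * f j) r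
  have h₃ : p * ∑ j ∈ Finset.range r, p ^ (r - 1 - j) * f j =
      ∑ j ∈ Finset.range r, p ^ (r - j) * f j := by
    rw [Finset.mul_sum]
    refine Finset.sum_congr rfl fun j hj => ?_
    have : r - j = r - 1 - j + 1 := by
      have := Finset.mem_range.mp hj
      omega
    rw [this, pow_succ]
    ring
  have h₄ : ∑ j ∈ Finset.range r, p ^ (r - 1 - j) * f (j + 1) =
      ∑ j ∈ Finset.range r, p ^ (r - (j + 1)) * f (j + 1) :=
    Finset.sum_congr rfl fun j _ => by rw [Nat.sub_sub, Nat.add_comm 1 j]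
  simp only [Nat.sub_self, Nat.sub_zero, pow_zero, one_mul] at h₁ h₂
  linarith

theorem mul_alph_sub_alph_add_one (p r : ℕ) (J : Finset (ZMod r)) (b : ZMod r → ℤ)
    (i : ZMod r) :
    (p : ℤ) * alph p r J b i - alph p r J b (i + 1) =
      (b i * (1 - dlt J i) - (1 - dlt J (i + 1))) * ((p : ℤ) ^ r - 1) := by
  have h := mul_sum_pow_mul_add (p : ℤ) r fun j =>
    b (i + (j : ZMod r)) * (1 - dlt J (i + (j : ZMod r))) - (1 - dlt J (i + (j : ZMod r) + 1))
  have hcomm (j : ℕ) : i + 1 + (j : ZMod r) = i + ((j : ZMod r) + 1) := by ring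
  simp only [Nat.cast_add, Nat.cast_one, Nat.cast_zero, CharP.cast_eq_zero, add_zero] at h
  simp only [alph, hcomm]
  linarith

/-- For every i with i+1 ∈ J, n_i ≥ β_(i+1). -/
theorem stmt9 (p r : ℕ) (hp : p.Prime) (hp5 : 5 ≤ p) (hr : 1 ≤ r)
    (J : Finset (ZMod r)) (b : ZMod r → ℤ)
    (hb : ∀ i : ZMod r, 2 ≤ b i ∧ b i ≤ (p : ℤ) - 2) :
    ∀ i : ZMod r, i + 1 ∈ J → bet p r J b (i + 1) ≤ nn p r J b i := by
  intro i hi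
  have hp0 : (0 : ℤ) ≤ p := by positivity
  have hp5' : (5 : ℤ) ≤ p := by exact_mod_cast hp5
  have he : (p : ℤ) ^ r - 1 ≤ ((p : ℤ) - 2) * ((p : ℤ) ^ r - 1) :=
    le_mul_of_one_le_left (sub_nonneg.mpr (one_le_pow₀ (by linarith))) (by linarith)
  have hi1 : dlt J (i + 1) = 1 := if_pos hi
  rcases dlt_eq_zero_or_one J i with h0 | h0
  · have hrec := mul_alph_sub_alph_add_one p r J b i
    have hle : bet p r J b (i + 1) - alph p r J b (i + 1) ≤ (p : ℤ) ^ r - 1 := by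
      simp only [bet, alph, ← Finset.sum_sub_distrib, ← mul_sub]
      refine sum_pow_mul_le_pow_sub_one hp0 r fun j => ?_
      have := hb (i + 1 + (j : ZMod r))
      rcases dlt_eq_zero_or_one J (i + 1 + (j : ZMod r)) with h | h <;>
      rcases dlt_eq_zero_or_one J (i + 1 + (j : ZMod r) + 1) with h' | h' <;>
      rw [h, h'] <;> linarith
    simp only [nn, h0, hi1] at hrec ⊢
    linarith
  · have hle : bet p r J b (i + 1) ≤ (p : ℤ) ^ r - 1 := by
      refine sum_pow_mul_le_pow_sub_one hp0 r fun j => ?_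
      have := hb (i + 1 + (j : ZMod r))
      rcases dlt_eq_zero_or_one J (i + 1 + (j : ZMod r)) with h | h <;>
      rcases dlt_eq_zero_or_one J (i + 1 + (j : ZMod r) + 1) with h' | h' <;>
      rw [h, h'] <;> linarith
    simp only [nn, h0, hi1]
    linarith
end

section
/- For every i ∈ ℤ/rℤ with i+1 ∈ J, one has n'_i + β_{i+1} ≤ e·(p−2). -/
open Finset

lemma dlt_nonneg {r : ℕ} (J : Finset (ZMod r)) (i : ZMod r) : 0 ≤ dlt J i := by
  unfold dlt
  split_ifs <;> norm_num

/-- An expansion in base `p` with `n` digits, all at most `p - 1`, is at most `p ^ n - 1`. -/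
lemma sum_pow_mul_le_pow_sub_one_s10 (p n : ℕ) (x : ℕ → ℤ) (hx : ∀ j, x j ≤ (p : ℤ) - 1) :
    ∑ j ∈ range n, (p : ℤ) ^ (n - 1 - j) * x j ≤ (p : ℤ) ^ n - 1 := by
  calc ∑ j ∈ range n, (p : ℤ) ^ (n - 1 - j) * x j
      ≤ ∑ j ∈ range n, (p : ℤ) ^ (n - 1 - j) * ((p : ℤ) - 1) := by
        gcongr with j _
        exact hx j
    _ = (p : ℤ) ^ n - 1 := by
        rw [← sum_mul, sum_range_reflect (fun j => (p : ℤ) ^ j) n, geom_sum_mul]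

/-- The leading digit of `bet p r J b i` controls its size. -/
lemma bet_le (p s : ℕ) (hp : 1 ≤ p) (J : Finset (ZMod (s + 1))) (b : ZMod (s + 1) → ℤ)
    (hb : ∀ i, b i ≤ (p : ℤ) - 1) (i : ZMod (s + 1)) :
    bet p (s + 1) J b i ≤
      (p : ℤ) ^ s * (b i * dlt J i - dlt J (i + 1)) + ((p : ℤ) ^ s - 1) := by
  have digit_le (k : ZMod (s + 1)) : b k * dlt J k - dlt J (k + 1) ≤ (p : ℤ) - 1 := by
    have hk := hb k
    have hnn := dlt_nonneg J (k + 1)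
    have hp' : (1 : ℤ) ≤ p := mod_cast hp
    unfold dlt at hnn ⊢
    split_ifs at hnn ⊢ <;> linarith
  have htail := sum_pow_mul_le_pow_sub_one_s10 p s
    (fun j => b (i + ((j + 1 : ℕ) : ZMod (s + 1))) * dlt J (i + ((j + 1 : ℕ) : ZMod (s + 1))) -
      dlt J (i + ((j + 1 : ℕ) : ZMod (s + 1)) + 1)) (fun j => digit_le _)
  have hexp (j : ℕ) : s + 1 - 1 - (j + 1) = s - 1 - j := by omega
  unfold bet
  rw [sum_range_succ', add_comm]
  simp only [hexp]
  simpa using htail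

/-- For every i with i+1 ∈ J, n'_i + β_(i+1) ≤ e*(p-2). -/
theorem stmt10 (p r : ℕ) (hp : p.Prime) (hp5 : 5 ≤ p) (hr : 1 ≤ r)
    (J : Finset (ZMod r)) (b : ZMod r → ℤ)
    (hb : ∀ i : ZMod r, 2 ≤ b i ∧ b i ≤ (p : ℤ) - 2) :
    ∀ i : ZMod r, i + 1 ∈ J →
      nn' p r J b i + bet p r J b (i + 1) ≤ ((p : ℤ) ^ r - 1) * ((p : ℤ) - 2) := by
  intro i hi
  obtain ⟨s, rfl⟩ := Nat.exists_eq_add_of_le' hr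
  have hi1 : dlt J (i + 1) = 1 := if_pos hi
  have hbet := bet_le p s (by omega) J b (fun k => by linarith [(hb k).2]) i
  rw [hi1] at hbet
  unfold nn'
  rw [hi1]
  by_cases h : i ∈ J
  · have hi0 : dlt J i = 1 := if_pos h
    rw [hi0] at hbet ⊢
    have hmul := mul_le_mul_of_nonneg_left hbet (Int.natCast_nonneg p)
    have hbi := (hb i).2
    rw [pow_succ]
    linarith
  · have hi0 : dlt J i = 0 := if_neg h
    rw [hi0]
    linarith
end

section
/- For every i ∈ ℤ/rℤ with i ∈ J, one has p·β_i − e·b_i ≤ 0. -/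
open Finset

/-- If `x (j + 1) ≤ q * d (j + 1)` for all `j`, the base-`q` sum with digits `x j - d (j + 1)`
is at most what its leading and last terms contribute. -/
theorem sum_pow_mul_sub_succ_le (q : ℤ) (hq : 0 ≤ q) (x d : ℕ → ℤ)
    (h : ∀ j, x (j + 1) ≤ q * d (j + 1)) (n : ℕ) :
    ∑ j ∈ Finset.range (n + 1), q ^ (n - j) * (x j - d (j + 1)) ≤ q ^ n * x 0 - d (n + 1) := by
  induction n with
  | zero => simp
  | succ n ih =>
    have hstep : ∑ j ∈ Finset.range (n + 1), q ^ (n + 1 - j) * (x j - d (j + 1)) =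
        q * ∑ j ∈ Finset.range (n + 1), q ^ (n - j) * (x j - d (j + 1)) := by
      rw [Finset.mul_sum]
      refine Finset.sum_congr rfl fun j hj => ?_
      rw [Nat.succ_sub (Nat.lt_succ_iff.mp (Finset.mem_range.mp hj)), pow_succ]
      ring
    rw [Finset.sum_range_succ, hstep, Nat.sub_self, pow_zero, one_mul, pow_succ]
    nlinarith [mul_le_mul_of_nonneg_left ih hq, h n]

/-- For every i ∈ J, p*β_i - e*b_i ≤ 0. -/
theorem stmt11 (p r : ℕ) (hp : p.Prime) (hp5 : 5 ≤ p) (hr : 1 ≤ r)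
    (J : Finset (ZMod r)) (b : ZMod r → ℤ)
    (hb : ∀ i : ZMod r, 2 ≤ b i ∧ b i ≤ (p : ℤ) - 2) :
    ∀ i : ZMod r, i ∈ J → (p : ℤ) * bet p r J b i - ((p : ℤ) ^ r - 1) * b i ≤ 0 := by
  intro i hi
  obtain ⟨n, rfl⟩ : ∃ n, r = n + 1 := ⟨r - 1, by omega⟩
  have hp0 : (0 : ℤ) ≤ p := Int.natCast_nonneg p
  have key := sum_pow_mul_sub_succ_le (p : ℤ) hp0
    (fun j => b (i + (j : ZMod (n + 1))) * dlt J (i + (j : ZMod (n + 1))))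
    (fun j => dlt J (i + (j : ZMod (n + 1)))) (fun j => by
      refine mul_le_mul_of_nonneg_right (by linarith [(hb (i + ((j + 1 : ℕ) : ZMod (n + 1)))).2]) ?_
      unfold dlt
      split_ifs <;> norm_num) n
  have hd : dlt J i = 1 := if_pos hi
  have hbet : bet p (n + 1) J b i ≤ (p : ℤ) ^ n * b i - 1 := by
    simp only [ZMod.natCast_self, Nat.cast_zero, add_zero, hd, mul_one] at key
    simpa only [bet, Nat.add_sub_cancel, Nat.cast_succ, ← add_assoc] using key
  rw [pow_succ]
  nlinarith [mul_le_mul_of_nonneg_left hbet hp0, (hb i).2]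
end

section
/- Define c_i = b_i − δ_J(i+1) if i ∈ J and c_i = p − b_i − δ_J(i+1) if i ∉ J. Suppose J', K' ⊆ ℤ/rℤ satisfy the congruence Σ_{i∈ℤ/rℤ} (c_i + δ_J(i+1))·w(i) ≡ Σ_{i∈(J'∩K')∪(J'^c∩K'^c)} (c_i + δ_{J'}(i+1))·w(i) + Σ_{i∈ℤ/rℤ : i+1∈K'∩J'^c} w(i) (mod p^r − 1). Then J' = K' and J' = J. (This is the combinatorial content of the proposition that, for a regular weight σ_{a,b} compatible with a reducible local representation via J, σ_{a,b} is the unique Jordan–Hölder factor of the mod-p reduction of the type I_{a,b,J} compatible with that representation.) -/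
open Finset

/-- `w(i) = p^((r − i.val) % r)`, so that `p·w(i+1) ≡ w(i) (mod p^r − 1)`. -/
def wgt (p r : ℕ) (i : ZMod r) : ℤ := (p : ℤ) ^ ((r - i.val) % r)

/-- A vanishing base-`p` expansion with integer digits of absolute value less than `p` has
all its digits equal to zero. -/
theorem digits_eq_zero_of_sum_eq_zero {p : ℤ} (hp : 0 < p) (r : ℕ) (f : ℕ → ℤ)
    (hf : ∀ i < r, |f i| < p) (h : ∑ i ∈ range r, f i * p ^ i = 0) :
    ∀ i < r, f i = 0 := by
  induction r generalizing f with
  | zero => simp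
  | succ r ih =>
    have hs : p * (∑ i ∈ range r, f (i + 1) * p ^ i) + f 0 = 0 := by
      rw [sum_range_succ'] at h
      rw [mul_sum, ← h]
      congr 1
      · exact sum_congr rfl fun i _ => by ring
      · simp
    have h0 : f 0 = 0 := by
      refine Int.eq_zero_of_abs_lt_dvd ?_ (hf 0 r.succ_pos)
      exact (Dvd.intro _ rfl : p ∣ p * -(∑ i ∈ range r, f (i + 1) * p ^ i)).trans
        (dvd_of_eq (by linarith))
    have hs' : ∑ i ∈ range r, f (i + 1) * p ^ i = 0 := by
      rw [h0, add_zero] at hs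
      exact (mul_eq_zero.mp hs).resolve_left hp.ne'
    intro i hi
    cases i with
    | zero => exact h0
    | succ i =>
      exact ih (fun i => f (i + 1)) (fun i hi => hf _ (by omega)) hs' i (by omega)

/-- Digits of absolute value at most `p - 2` whose base-`p` expansion of length `r` is divisible
by `p ^ r - 1` all vanish. -/
theorem digits_eq_zero_of_dvd {p : ℤ} (hp : 2 ≤ p) (r : ℕ) (f : ℕ → ℤ)
    (hf : ∀ i < r, |f i| ≤ p - 2) (h : p ^ r - 1 ∣ ∑ i ∈ range r, f i * p ^ i) :
    ∀ i < r, f i = 0 := by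
  rcases Nat.eq_zero_or_pos r with rfl | hr
  · simp
  refine digits_eq_zero_of_sum_eq_zero (by omega) r f
    (fun i hi => (hf i hi).trans_lt (by omega)) (Int.eq_zero_of_abs_lt_dvd h ?_)
  have hgeom : (∑ i ∈ range r, p ^ i) * (p - 1) = p ^ r - 1 := geom_sum_mul p r
  have hpos : 0 < ∑ i ∈ range r, p ^ i :=
    sum_pos (fun i _ => by positivity) (nonempty_range_iff.mpr hr.ne')
  calc |∑ i ∈ range r, f i * p ^ i| ≤ ∑ i ∈ range r, |f i * p ^ i| := abs_sum_le_sum_abs _ _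
    _ ≤ ∑ i ∈ range r, (p - 2) * p ^ i := by
      refine sum_le_sum fun i hi => ?_
      have hpi : 0 ≤ p ^ i := by positivity
      rw [abs_mul, abs_of_nonneg hpi]
      exact mul_le_mul_of_nonneg_right (hf i (mem_range.mp hi)) hpi
    _ = (p - 2) * ∑ i ∈ range r, p ^ i := (mul_sum ..).symm
    _ < p ^ r - 1 := by rw [← hgeom]; linarith

theorem wgt_eq_pow_val_neg (p r : ℕ) [NeZero r] (i : ZMod r) :
    wgt p r i = (p : ℤ) ^ (-i).val := by
  rw [wgt, ZMod.neg_val']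

theorem sum_mul_wgt (p r : ℕ) [NeZero r] (x : ZMod r → ℤ) :
    ∑ i, x i * wgt p r i = ∑ k ∈ range r, x (-(k : ZMod r)) * (p : ℤ) ^ k := by
  refine sum_nbij' (fun i => (-i).val) (fun k => -(k : ZMod r)) ?_ ?_ ?_ ?_ ?_
  · exact fun i _ => mem_range.mpr (ZMod.val_lt _)
  · simp
  · simp
  · intro k hk
    simp [ZMod.val_natCast, Nat.mod_eq_of_lt (mem_range.mp hk)]
  · intro i _
    simp [wgt_eq_pow_val_neg]

theorem eq_zero_of_dvd_sum_mul_wgt {p r : ℕ} [NeZero r] (hp : 2 ≤ p) (x : ZMod r → ℤ)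
    (hx : ∀ i, |x i| ≤ (p : ℤ) - 2) (h : (p : ℤ) ^ r - 1 ∣ ∑ i, x i * wgt p r i)
    (i : ZMod r) : x i = 0 := by
  rw [sum_mul_wgt] at h
  simpa using digits_eq_zero_of_dvd (by exact_mod_cast hp) r _ (fun k _ => hx _) h
    (-i).val (ZMod.val_lt _)

/-- The combinatorial content of Proposition `typeswts` (reducible case):
with `c_i = b_i − δ_J(i+1)` if `i ∈ J` and `c_i = p − b_i − δ_J(i+1)` otherwise,
if `J', K' ⊆ ℤ/rℤ` satisfy the displayed congruence modulo `p^r − 1`, then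
`J' = K'` and `J' = J`. -/
theorem stmt14 (p r : ℕ) [NeZero r] (hp : p.Prime) (hp5 : 5 ≤ p)
    (J : Finset (ZMod r)) (b : ZMod r → ℤ)
    (hb : ∀ i : ZMod r, 2 ≤ b i ∧ b i ≤ (p : ℤ) - 2)
    (c : ZMod r → ℤ)
    (hc : ∀ i : ZMod r,
      c i = if i ∈ J then b i - dlt J (i + 1) else (p : ℤ) - b i - dlt J (i + 1))
    (J' K' : Finset (ZMod r))
    (hcong : (∑ i : ZMod r, (c i + dlt J (i + 1)) * wgt p r i) ≡
      (∑ i ∈ (J' ∩ K') ∪ (J'ᶜ ∩ K'ᶜ), (c i + dlt J' (i + 1)) * wgt p r i) +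
        (∑ i ∈ Finset.univ.filter (fun i : ZMod r => i + 1 ∈ K' ∩ J'ᶜ), wgt p r i)
      [ZMOD (p : ℤ) ^ r - 1]) :
    J' = K' ∧ J' = J := by
  set S := (J' ∩ K') ∪ (J'ᶜ ∩ K'ᶜ) with hS
  have hmemS (i : ZMod r) : i ∈ S ↔ (i ∈ J' ↔ i ∈ K') := by
    simp only [hS, mem_union, mem_inter, mem_compl]
    tauto
  let x (i : ZMod r) : ℤ := (c i + dlt J (i + 1)) -
    (if i ∈ S then c i + dlt J' (i + 1) else 0) - (if i + 1 ∈ K' ∩ J'ᶜ then 1 else 0)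
  have hdvd : (p : ℤ) ^ r - 1 ∣ ∑ i, x i * wgt p r i := by
    convert hcong.symm.dvd using 1
    simp only [x, sub_mul, sum_sub_distrib, ite_mul, zero_mul, one_mul, sum_ite_mem, univ_inter,
      sum_filter]
    rw [sub_sub]
  have hx0 : ∀ i, x i = 0 := by
    refine eq_zero_of_dvd_sum_mul_wgt (by omega) x (fun i => ?_) hdvd
    have hbi := hb i
    have hp5' : (5 : ℤ) ≤ p := by exact_mod_cast hp5
    rw [abs_le]
    simp only [x, hc, dlt, mem_inter, mem_compl]
    split_ifs <;> omega
  have hJK : J' = K' := by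
    ext i
    by_contra hi
    have hxi := hx0 i
    have hbi := hb i
    simp only [x, hc, dlt, if_neg (mt (hmemS i).mp hi)] at hxi
    split_ifs at hxi <;> omega
  refine ⟨hJK, ?_⟩
  ext i
  have hxi := hx0 (i - 1)
  simp only [x, (hmemS (i - 1)).mpr (by rw [hJK]), if_true, sub_add_cancel, hJK, dlt,
    mem_inter, mem_compl] at hxi
  rw [hJK]
  split_ifs at hxi <;> first | tauto | omega
end

section
/- Let c_i (i ∈ ℤ/rℤ) be integers with 0 ≤ c_i ≤ p − 1. Let Z ⊆ ℤ/rℤ, let Y = {i ∈ ℤ/rℤ : δ_Z(i) ≠ δ_Z(i+1)}, and let X ⊆ ℤ/rℤ satisfy X ∩ Y = Y ∩ Z. Set K = {i ∈ ℤ/rℤ : i−1 ∈ (X^c ∩ Y^c ∩ Z) ∪ (X ∩ Y^c ∩ Z^c)} and L = (K^c ∩ Z) ∪ (K ∩ Z^c). Then Σ_{i∈Z} c_i·w(i) + Σ_{i∈X} w(i) ≡ Σ_{i∈(K^c∩L)∪(K∩L^c)} (c_i + δ_{K^c}(i+1))·w(i) + Σ_{i∈ℤ/rℤ} δ_{K∩L}(i+1)·w(i)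 (mod p^r − 1). (This is the concluding congruence in the proof that a reducible local representation with a potentially Barsotti–Tate lift of tame type θ₁⊕θ₂ is compatible with some weight occurring in the mod-p reduction of I(θ₁,θ₂).) -/
open Finset

/-- The concluding congruence in the proof of Proposition `jhcompat`. -/
theorem stmt18 (p r : ℕ) [NeZero r] (hp : p.Prime) (hp5 : 5 ≤ p)
    (c : ZMod r → ℤ) (hc : ∀ i : ZMod r, 0 ≤ c i ∧ c i ≤ (p : ℤ) - 1)
    (Z X Y K L : Finset (ZMod r))
    (hY : Y = Finset.univ.filter (fun i : ZMod r => ¬ ((i ∈ Z) ↔ (i + 1 ∈ Z))))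
    (hX : X ∩ Y = Y ∩ Z)
    (hK : K = Finset.univ.filter
      (fun i : ZMod r => i - 1 ∈ (Xᶜ ∩ Yᶜ ∩ Z) ∪ (X ∩ Yᶜ ∩ Zᶜ)))
    (hL : L = (Kᶜ ∩ Z) ∪ (K ∩ Zᶜ)) :
    (∑ i ∈ Z, c i * wgt p r i) + (∑ i ∈ X, wgt p r i) ≡
      (∑ i ∈ (Kᶜ ∩ L) ∪ (K ∩ Lᶜ), (c i + dlt Kᶜ (i + 1)) * wgt p r i) +
        (∑ i : ZMod r, dlt (K ∩ L) (i + 1) * wgt p r i) [ZMOD (p : ℤ) ^ r - 1] := by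
  have hKL : (Kᶜ ∩ L) ∪ (K ∩ Lᶜ) = Z := by
    ext i
    simp only [hL, mem_union, mem_inter, mem_compl]
    tauto
  have hdlt (i : ZMod r) :
      dlt X i = dlt Z i * dlt Kᶜ (i + 1) + dlt (K ∩ L) (i + 1) := by
    have hYi : i ∈ Y ↔ ¬ (i ∈ Z ↔ i + 1 ∈ Z) := by simp [hY]
    have hXi : i ∈ X ∧ i ∈ Y ↔ i ∈ Y ∧ i ∈ Z := by
      simpa only [mem_inter] using Finset.ext_iff.mp hX i
    have hKi : i + 1 ∈ K ↔
        ((i ∉ X ∧ i ∉ Y) ∧ i ∈ Z) ∨ ((i ∈ X ∧ i ∉ Y) ∧ i ∉ Z) := by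
      simp [hK, and_assoc]
    have hLi : i + 1 ∈ L ↔
        (i + 1 ∉ K ∧ i + 1 ∈ Z) ∨ (i + 1 ∈ K ∧ i + 1 ∉ Z) := by
      simp only [hL, mem_union, mem_inter, mem_compl]
    simp only [dlt, mem_inter, mem_compl]
    by_cases h₁ : i ∈ X <;> by_cases h₂ : i ∈ Z <;> by_cases h₃ : i + 1 ∈ Z <;>
      simp_all
  have hsum (S : Finset (ZMod r)) (f : ZMod r → ℤ) :
      ∑ i ∈ S, f i = ∑ i : ZMod r, dlt S i * f i := by
    simp [dlt]
  rw [hKL, hsum Z, hsum X, hsum Z, ← sum_add_distrib, ← sum_add_distrib]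
  refine congrArg (· % ((p : ℤ) ^ r - 1)) (sum_congr rfl fun i _ => ?_)
  rw [hdlt i]
  ring
end

section
/- Let j ∈ ℤ/rℤ and let b be an integer with 2 ≤ b ≤ p − 1. Then there do not exist a subset J ⊆ ℤ/rℤ and integers n_i (i ∈ ℤ/rℤ) with 2 ≤ n_i ≤ p − 2 such that w(j−1) + Σ_{i∈J} n_i·w(i) ≡ (b−1)·w(j) + Σ_{i∈J^c} n_i·w(i) (mod p^r − 1). (This is the concluding step in the proof that a representation whose semisimplified restriction to inertia is ω_{τ_j}^{b−1}·∏_{i≠j}ω_{τ_i}^{p−1} ⊕ ω_{τ_j} is not compatible with any regular weight.) -/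
open Finset

/-- Powers of `q` modulo `q ^ r - 1` depend only on the exponent modulo `r`. -/
lemma pow_mod_modEq_pow (q : ℤ) (r a : ℕ) : q ^ (a % r) ≡ q ^ a [ZMOD q ^ r - 1] := by
  have h : q ^ r ≡ 1 [ZMOD q ^ r - 1] := (Int.modEq_sub _ _)
  conv_rhs => rw [← Nat.mod_add_div a r, pow_add, pow_mul]
  simpa using ((h.pow (a / r)).mul_left (q ^ (a % r))).symm

lemma wgt_modEq_pow {p r : ℕ} [NeZero r] {i : ZMod r} {a : ℕ} (h : (a : ZMod r) = -i) :
    wgt p r i ≡ (p : ℤ) ^ a [ZMOD (p : ℤ) ^ r - 1] := by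
  have h' : ((r - i.val : ℕ) : ZMod r) = (a : ZMod r) := by
    rw [Nat.cast_sub i.val_lt.le, h]
    simp
  rw [wgt, (ZMod.natCast_eq_natCast_iff' _ _ _).1 h']
  exact pow_mod_modEq_pow _ _ _

lemma wgt_sub_natCast_modEq (p r : ℕ) [NeZero r] (j : ZMod r) (k : ℕ) :
    wgt p r (j - k) ≡ wgt p r j * (p : ℤ) ^ k [ZMOD (p : ℤ) ^ r - 1] := by
  have h : (((r - j.val) % r : ℕ) : ZMod r) = -j := by
    rw [ZMod.natCast_mod, Nat.cast_sub j.val_lt.le]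
    simp
  rw [wgt.eq_def p r j, ← pow_add]
  apply wgt_modEq_pow
  rw [Nat.cast_add, h]
  ring

lemma isCoprime_wgt (p r : ℕ) [NeZero r] (i : ZMod r) :
    IsCoprime ((p : ℤ) ^ r - 1) (wgt p r i) := by
  have h : IsCoprime ((p : ℤ) ^ r - 1) ((p : ℤ) ^ r) := ⟨-1, 1, by ring⟩
  exact ((IsCoprime.pow_right_iff (Nat.pos_of_neZero r)).1 h).pow_right

lemma ZMod.sum_eq_sum_range_sub {r : ℕ} [NeZero r] {M : Type*} [AddCommMonoid M]
    (j : ZMod r) (f : ZMod r → M) : ∑ i, f i = ∑ k ∈ range r, f (j - k) := by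
  rw [← Equiv.sum_comp (Equiv.subLeft j) f]
  refine Finset.sum_nbij' ZMod.val (fun k => (k : ZMod r)) ?_ ?_ ?_ ?_ ?_
  · exact fun i _ => Finset.mem_range.2 i.val_lt
  · simp
  · simp
  · exact fun k hk => ZMod.val_cast_of_lt (Finset.mem_range.1 hk)
  · simp

lemma abs_sum_mul_pow_le {q : ℤ} (hq : 2 ≤ q) (m : ℕ) (z : ℕ → ℤ)
    (hz : ∀ k ≤ m, |z k| ≤ q - 2) :
    |∑ k ∈ range (m + 1), z k * q ^ k| ≤ q ^ (m + 1) - 2 := by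
  induction m with
  | zero => simpa using hz 0 le_rfl
  | succ m ih =>
    rw [Finset.sum_range_succ]
    have hpow : 0 < q ^ (m + 1) := by positivity
    have h1 := ih fun k hk => hz k (by lia)
    have h2 : |z (m + 1) * q ^ (m + 1)| ≤ (q - 2) * q ^ (m + 1) := by
      rw [abs_mul, abs_of_pos hpow]
      exact mul_le_mul_of_nonneg_right (hz _ le_rfl) hpow.le
    have h3 := abs_add_le (∑ k ∈ range (m + 1), z k * q ^ k) (z (m + 1) * q ^ (m + 1))
    rw [pow_succ q (m + 1)]
    nlinarith

/-- A base `q` expansion with signed digits of absolute value in `[2, q - 2]`, apart from a leading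
constant digit of absolute value at most `2 * q - 3`, is not divisible by `q ^ r - 1`. -/
lemma not_dvd_sum_mul_pow {q : ℤ} (hq : 2 ≤ q) {r : ℕ} (hr : 2 ≤ r) (z : ℕ → ℤ)
    (hz₀ : |z 0| ≤ 2 * q - 3) (hz : ∀ k, 0 < k → k < r → 2 ≤ |z k| ∧ |z k| ≤ q - 2) :
    ¬ q ^ r - 1 ∣ ∑ k ∈ range r, z k * q ^ k := by
  intro hdvd
  obtain ⟨m, rfl⟩ := Nat.exists_eq_add_of_le' hr
  have hU := abs_sum_mul_pow_le hq m (fun k => z (k + 1))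
    fun k hk => (hz (k + 1) (by lia) (by lia)).2
  have hsum : ∀ (n : ℕ) (y : ℕ → ℤ), ∑ k ∈ range (n + 1), y k * q ^ k =
      y 0 + q * ∑ k ∈ range n, y (k + 1) * q ^ k := by
    intro n y
    rw [Finset.sum_range_succ', Finset.mul_sum, add_comm]
    congr 1
    · simp
    · exact Finset.sum_congr rfl fun k _ => by ring
  rw [hsum] at hdvd
  have hT := hsum m fun k => z (k + 1)
  set U := ∑ k ∈ range (m + 1), z (k + 1) * q ^ k
  set T := ∑ k ∈ range m, z (k + 1 + 1) * q ^ k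
  have hzero : z 0 + q * U = 0 := by
    refine Int.eq_zero_of_abs_lt_dvd hdvd ?_
    have h := abs_add_le (z 0) (q * U)
    rw [abs_mul, abs_of_pos (by lia : 0 < q)] at h
    rw [pow_succ q (m + 1)]
    nlinarith
  have hU_abs : |U| ≤ 1 := by
    have h : q * |U| = |z 0| := by
      rw [show z 0 = -(q * U) by lia, abs_neg, abs_mul, abs_of_pos (by lia : 0 < q)]
    by_contra! hlt
    nlinarith
  obtain ⟨h1, h2⟩ := hz 1 one_pos (by lia)
  have h3 : z 1 - U = 0 := by
    refine Int.eq_zero_of_abs_lt_dvd (m := q) ⟨-T, by simp only [zero_add] at hT; linarith⟩ ?_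
    have := abs_sub (z 1) U
    lia
  rw [sub_eq_zero.1 h3] at h1
  lia

/-- There is no subset `J` and regular exponents `n_i ∈ [2, p−2]` such that
`w(j−1) + Σ_{i∈J} n_i w(i) ≡ (b−1) w(j) + Σ_{i∈J^c} n_i w(i) (mod p^r − 1)`. -/
theorem stmt19 (p r : ℕ) [NeZero r] (hp : p.Prime) (hp5 : 5 ≤ p) (hr : 2 ≤ r)
    (j : ZMod r) (b : ℤ) (hb : 2 ≤ b ∧ b ≤ (p : ℤ) - 1) :
    ¬ ∃ (J : Finset (ZMod r)) (n : ZMod r → ℤ),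
      (∀ i : ZMod r, 2 ≤ n i ∧ n i ≤ (p : ℤ) - 2) ∧
      (wgt p r (j - 1) + ∑ i ∈ J, n i * wgt p r i ≡
        (b - 1) * wgt p r j + ∑ i ∈ Jᶜ, n i * wgt p r i [ZMOD (p : ℤ) ^ r - 1]) := by
  rintro ⟨J, n, hn, hmod⟩
  let s : ZMod r → ℤ := fun i => if i ∈ J then n i else -n i
  let c : ZMod r → ℤ := fun i => s i + if i = j then p - b + 1 else 0
  have hs : ∀ i, 2 ≤ |s i| ∧ |s i| ≤ (p : ℤ) - 2 := by
    intro i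
    have h : |s i| = n i := by
      have := hn i
      by_cases hi : i ∈ J <;> simp [s, hi] <;> lia
    rw [h]
    exact hn i
  have hsum : ∑ i, s i * wgt p r i = ∑ i ∈ J, n i * wgt p r i - ∑ i ∈ Jᶜ, n i * wgt p r i := by
    rw [← Finset.sum_add_sum_compl J, sub_eq_add_neg, ← Finset.sum_neg_distrib]
    congr 1
    · exact Finset.sum_congr rfl fun i hi => by simp [s, hi]
    · exact Finset.sum_congr rfl fun i hi => by simp [s, Finset.mem_compl.1 hi]
  have hc : ∑ i, c i * wgt p r i = ∑ i, s i * wgt p r i + (p - b + 1) * wgt p r j := by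
    simp [c, add_mul, Finset.sum_add_distrib]
  have hj : wgt p r (j - 1) ≡ wgt p r j * p [ZMOD (p : ℤ) ^ r - 1] := by
    simpa using wgt_sub_natCast_modEq p r j 1
  have hc_dvd : (p : ℤ) ^ r - 1 ∣ ∑ i, c i * wgt p r i := by
    rw [hc, hsum]
    refine (dvd_add hmod.symm.dvd hj.dvd).trans (dvd_of_eq ?_)
    ring
  have hrot : ∑ i, c i * wgt p r i ≡
      wgt p r j * ∑ k ∈ range r, c (j - k) * (p : ℤ) ^ k [ZMOD (p : ℤ) ^ r - 1] := by
    rw [ZMod.sum_eq_sum_range_sub j, Finset.mul_sum]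
    refine Int.ModEq.sum fun k _ => ?_
    rw [mul_left_comm]
    exact (wgt_sub_natCast_modEq p r j k).mul_left _
  refine not_dvd_sum_mul_pow (q := p) (by lia) hr (fun k => c (j - k)) ?_ ?_
    ((isCoprime_wgt p r j).dvd_of_dvd_mul_left (hrot.dvd_iff.1 hc_dvd))
  · simp only [Nat.cast_zero, sub_zero, c, if_true]
    refine (abs_add_le _ _).trans ?_
    rw [abs_of_pos (by lia : (0 : ℤ) < p - b + 1)]
    linarith [(hs j).2]
  · intro k hk hkr
    have hne : (k : ZMod r) ≠ 0 := by
      rw [Ne, ZMod.natCast_eq_zero_iff]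
      exact Nat.not_dvd_of_pos_of_lt hk hkr
    simpa [c, hne] using hs (j - k)
end
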